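/- arXiv:2407.15780 — 12 statements merged into one kernel-verified Lean document; each statement's English description precedes it below -/
import Mathlib

section
/- Let F be a finite set of features, M a model over F, and e an example over F. A set A ⊆ F is a local contrastive explanation of minimum cardinality for e with respect to M if and only if M(e_A) ≠ M(e) and M(e_{A'}) = M(e) for every set A' ⊆ F with |A'| < |A|. In particular, every minimum-cardinality local contrastive explanation A for e with respect to M satisfies M(e_A) ≠ M(e). -/
/-- `A` is a local contrastive explanation (lCXp) for the example `e` w.r.t. the
model `M`: there is an example `e'` with `M e' ≠ M e` differing from `e` only on
features in `A`. -/
def IsLCXp {F : Type*} (M : (F → Bool) → Bool) (e : F → Bool) (A : Finset F) : Prop :=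
  ∃ e' : F → Bool, M e' ≠ M e ∧ ∀ f : F, e' f ≠ e f → f ∈ A

/-- `flipOn e A` is the example `e_A` obtained from `e` by flipping the value of
every feature in `A`. -/
def flipOn {F : Type*} [DecidableEq F] (e : F → Bool) (A : Finset F) : F → Bool :=
  fun f => if f ∈ A then !(e f) else e f

/-- A set is an lCXp iff flipping some subset of it changes the classification. -/
theorem isLCXp_iff_exists_subset_flipOn {F : Type*} [DecidableEq F]
    (M : (F → Bool) → Bool) (e : F → Bool) (B : Finset F) :
    IsLCXp M e B ↔ ∃ C ⊆ B, M (flipOn e C) ≠ M e := by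
  constructor
  · rintro ⟨e', hM, hB⟩
    refine ⟨B.filter fun f => e' f ≠ e f, Finset.filter_subset _ _, ?_⟩
    have h : flipOn e (B.filter fun f => e' f ≠ e f) = e' := by
      funext f
      by_cases hf : e' f = e f
      · simp [flipOn, hf]
      · simpa [flipOn, hf, hB f hf] using (Bool.eq_not_of_ne hf).symm
    rwa [h]
  · rintro ⟨C, hCB, hC⟩
    refine ⟨flipOn e C, hC, fun f hf => hCB ?_⟩
    by_contra hfC
    exact hf (by simp [flipOn, hfC])

/-- `A` is a minimum-cardinality local contrastive explanation for `e`
w.r.t. `M` iff `M (e_A) ≠ M e` and `M (e_{A'}) = M e` for every `A'` with `|A'| < |A|`;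
in particular every minimum-cardinality lCXp `A` satisfies `M (e_A) ≠ M e`. -/
theorem minimum_lCXp_characterization {F : Type*} [DecidableEq F]
    (M : (F → Bool) → Bool) (e : F → Bool) (A : Finset F) :
    ((IsLCXp M e A ∧ ∀ B : Finset F, IsLCXp M e B → A.card ≤ B.card) ↔
      (M (flipOn e A) ≠ M e ∧
        ∀ A' : Finset F, A'.card < A.card → M (flipOn e A') = M e)) ∧
    ((IsLCXp M e A ∧ ∀ B : Finset F, IsLCXp M e B → A.card ≤ B.card) →
      M (flipOn e A) ≠ M e) := by
  have key : (IsLCXp M e A ∧ ∀ B : Finset F, IsLCXp M e B → A.card ≤ B.card) ↔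
      (M (flipOn e A) ≠ M e ∧
        ∀ A' : Finset F, A'.card < A.card → M (flipOn e A') = M e) := by
    simp only [isLCXp_iff_exists_subset_flipOn]
    constructor
    · rintro ⟨⟨C, hCA, hC⟩, hmin⟩
      have hCeq : C = A := Finset.eq_of_subset_of_card_le hCA (hmin C ⟨C, subset_rfl, hC⟩)
      refine ⟨hCeq ▸ hC, fun A' hlt => ?_⟩
      by_contra hA'
      exact hlt.not_ge (hmin A' ⟨A', subset_rfl, hA'⟩)
    · rintro ⟨hA, hlt⟩
      refine ⟨⟨A, subset_rfl, hA⟩, ?_⟩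
      rintro B ⟨C, hCB, hC⟩
      by_contra! hBA
      exact hC (hlt C ((Finset.card_le_card hCB).trans_lt hBA))
  exact ⟨key, fun h => (key.mp h).1⟩
end

section
/- Let F be a finite set of features equipped with a linear order <, and let E be a finite set of examples over F. There exists a decision tree 𝒯 over F that is ordered w.r.t. <, has at most 2·|E|·|F| + 1 leaves, and satisfies 𝒯(e) = true if and only if e ∈ E, for every example e over F. -/
/-- A decision tree over the feature set `F`: a leaf carries a class in `Bool`,
an inner node carries a feature and has a 0-child and a 1-child. -/
inductive DT (F : Type*) where
  | leaf : Bool → DT F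
  | node : F → DT F → DT F → DT F

namespace DT

variable {F : Type*}

/-- Classification of an example by a decision tree. -/
def eval : DT F → (F → Bool) → Bool
  | .leaf b, _ => b
  | .node f t0 t1, e => if e f then t1.eval e else t0.eval e

/-- The number of leaves (the size) of a decision tree. -/
def numLeaves : DT F → ℕ
  | .leaf _ => 1
  | .node _ t0 t1 => t0.numLeaves + t1.numLeaves

/-- The set of features labeling the inner nodes of a decision tree. -/
def feats : DT F → Set F
  | .leaf _ => ∅
  | .node f t0 t1 => {f} ∪ t0.feats ∪ t1.feats

/-- A decision tree is ordered w.r.t. the order `<` on `F` if on every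
root-to-leaf path the features occur in strictly increasing order. -/
def Ordered [LT F] : DT F → Prop
  | .leaf _ => True
  | .node f t0 t1 =>
      (∀ g ∈ t0.feats, f < g) ∧ (∀ g ∈ t1.feats, f < g) ∧ t0.Ordered ∧ t1.Ordered

end DT

/-- Membership in `E` up to the values at the features of `S` is decided by an ordered decision
tree on the features of `S` with at most `|E|·|S| + 1` leaves. -/
theorem DT.exists_ordered_of_finset {F : Type*} [LinearOrder F] (S : Finset F) :
    ∀ E : Finset (F → Bool), ∃ T : DT F, T.feats ⊆ (S : Set F) ∧ T.Ordered ∧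
      T.numLeaves ≤ E.card * S.card + 1 ∧
      ∀ e : F → Bool, T.eval e = true ↔ ∃ e' ∈ E, ∀ f ∈ S, e f = e' f := by
  classical
  induction S using Finset.induction_on_min with
  | empty =>
    intro E
    refine ⟨.leaf (decide E.Nonempty), by simp [feats], by simp [Ordered], by simp [numLeaves], ?_⟩
    intro e
    rw [eval, decide_eq_true_iff]
    simp [Finset.Nonempty]
  | insert a S ha ih =>
    intro E
    rcases E.eq_empty_or_nonempty with rfl | hE
    · exact ⟨.leaf false, by simp [feats], by simp [Ordered], by simp [numLeaves], by simp [eval]⟩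
    obtain ⟨T₁, hf₁, ho₁, hn₁, he₁⟩ := ih (E.filter fun e => e a = true)
    obtain ⟨T₀, hf₀, ho₀, hn₀, he₀⟩ := ih (E.filter fun e => ¬ e a = true)
    refine ⟨.node a T₀ T₁, ?_, ⟨fun g hg => ha g (hf₀ hg), fun g hg => ha g (hf₁ hg), ho₀, ho₁⟩,
      ?_, fun e => ?_⟩
    · rintro g ((rfl | hg) | hg)
      · simp
      · simpa using Or.inr (hf₀ hg)
      · simpa using Or.inr (hf₁ hg)
    · have hcard := E.card_filter_add_card_filter_not (fun e => e a = true)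
      have haS : a ∉ S := fun h => lt_irrefl a (ha a h)
      have hpos := hE.card_pos
      rw [Finset.card_insert_of_notMem haS, numLeaves, ← hcard]
      rw [← hcard] at hpos
      nlinarith
    · cases hea : e a
      · simp [eval, he₀, and_assoc, hea, @eq_comm _ false]
      · simp [eval, he₁, and_assoc, hea, @eq_comm _ true]

/-- for every finite set `E` of examples over a linearly ordered
finite feature set `F`, there is a decision tree `T` over `F`, ordered w.r.t. `<`,
with at most `2·|E|·|F| + 1` leaves, such that `T e = true` iff `e ∈ E`. -/
theorem exists_ordered_DT_for_examples {F : Type*} [Fintype F] [LinearOrder F]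
    (E : Finset (F → Bool)) :
    ∃ T : DT F, T.Ordered ∧ T.numLeaves ≤ 2 * E.card * Fintype.card F + 1 ∧
      ∀ e : F → Bool, T.eval e = true ↔ e ∈ E := by
  obtain ⟨T, -, ho, hn, he⟩ := DT.exists_ordered_of_finset Finset.univ E
  refine ⟨T, ho, ?_, fun e => ?_⟩
  · rw [Finset.card_univ] at hn
    nlinarith
  · simp [he, ← funext_iff]
end

section
/- Let 𝒯 be a decision tree over a finite feature set F in which no feature labels two inner nodes on the same root-to-leaf path, let e be an example over F, and let A ⊆ F. Then A is a local abductive explanation for e w.r.t. 𝒯 if and only if every leaf of the restriction 𝒯|τ, where τ is the restriction of e to A, is labeled 𝒯(e). -/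
namespace DT

variable {F : Type*}

/-- No feature labels two inner nodes on the same root-to-leaf path. -/
def ReadOnce : DT F → Prop
  | .leaf _ => True
  | .node f t0 t1 => f ∉ t0.feats ∧ f ∉ t1.feats ∧ t0.ReadOnce ∧ t1.ReadOnce

/-- The restriction `T|τ` of a decision tree by the partial example with domain
`A` and values `τ`: every node labeled by a feature `f ∈ A` is replaced by the
subtree rooted at its `τ f`-child. -/
def restrict [DecidableEq F] : DT F → Finset F → (F → Bool) → DT F
  | .leaf b, _, _ => .leaf b
  | .node f t0 t1, A, τ =>
      if f ∈ A then (if τ f then t1.restrict A τ else t0.restrict A τ)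
      else .node f (t0.restrict A τ) (t1.restrict A τ)

/-- Every leaf of `T` is labeled `c`. -/
def AllLeaves : DT F → Bool → Prop
  | .leaf b, c => b = c
  | .node _ t0 t1, c => t0.AllLeaves c ∧ t1.AllLeaves c

end DT

/-- The value of a decision tree does not depend on features it does not test. -/
theorem DT.eval_update_of_notMem_feats {F : Type*} [DecidableEq F] (T : DT F) {f : F}
    (hf : f ∉ T.feats) (e : F → Bool) (b : Bool) :
    T.eval (Function.update e f b) = T.eval e := by
  induction T with
  | leaf _ => rfl
  | node g t0 t1 ih0 ih1 =>
    simp only [DT.feats, Set.mem_union, Set.mem_singleton_iff, not_or] at hf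
    obtain ⟨⟨hfg, h0⟩, h1⟩ := hf
    simp only [DT.eval, Function.update_of_ne (Ne.symm hfg), ih0 h0, ih1 h1]

/-- All leaves of `T|τ` are labeled `c` iff `T` has value `c` on all examples extending `τ`. -/
theorem DT.restrict_allLeaves_iff {F : Type*} [DecidableEq F] (T : DT F) (hT : T.ReadOnce)
    (e : F → Bool) (A : Finset F) (c : Bool) :
    (T.restrict A e).AllLeaves c ↔
      ∀ e' : F → Bool, (∀ f ∈ A, e' f = e f) → T.eval e' = c := by
  induction T with
  | leaf b => exact ⟨fun h _ _ => h, fun h => h e fun _ _ => rfl⟩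
  | node f t0 t1 ih0 ih1 =>
    obtain ⟨hf0, hf1, hT0, hT1⟩ := hT
    by_cases hA : f ∈ A
    · cases hef : e f
      · simp only [DT.restrict, hA, hef, if_true, Bool.false_eq_true, if_false, ih0 hT0]
        refine forall₂_congr fun e' he' => ?_
        simp [DT.eval, he' f hA, hef]
      · simp only [DT.restrict, hA, hef, if_true, ih1 hT1]
        refine forall₂_congr fun e' he' => ?_
        simp [DT.eval, he' f hA, hef]
    · simp only [DT.restrict, hA, if_false, DT.AllLeaves, ih0 hT0, ih1 hT1]
      constructor
      · rintro ⟨h0, h1⟩ e' he'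
        simp only [DT.eval, h0 e' he', h1 e' he', ite_self]
      · intro h
        have agree : ∀ e' : F → Bool, (∀ g ∈ A, e' g = e g) → ∀ b : Bool,
            ∀ g ∈ A, Function.update e' f b g = e g := fun e' he' b g hg => by
          rw [Function.update_of_ne (ne_of_mem_of_not_mem hg hA), he' g hg]
        refine ⟨fun e' he' => ?_, fun e' he' => ?_⟩
        · simpa [DT.eval, DT.eval_update_of_notMem_feats _ hf0] using h _ (agree e' he' false)
        · simpa [DT.eval, DT.eval_update_of_notMem_feats _ hf1] using h _ (agree e' he' true)

/-- for a decision tree `T` in which no feature labels two inner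
nodes on the same root-to-leaf path, an example `e` and a set `A` of features,
`A` is a local abductive explanation for `e` w.r.t. `T` iff every leaf of the
restriction `T|τ` (with `τ` the restriction of `e` to `A`) is labeled `T e`. -/
theorem DT_lAXp_iff_restrict_allLeaves {F : Type*} [DecidableEq F]
    (T : DT F) (hT : T.ReadOnce) (e : F → Bool) (A : Finset F) :
    (∀ e' : F → Bool, (∀ f ∈ A, e' f = e f) → T.eval e' = T.eval e) ↔
      (T.restrict A e).AllLeaves (T.eval e) := by
  exact (T.restrict_allLeaves_iff hT e A (T.eval e)).symm
end

section
/- Let 𝒯 be a decision tree over a finite feature set F in which no feature labels two inner nodes on the same root-to-leaf path, let τ be a partial example over F, and let c ∈ Bool. Then: (a) τ is a global abductive explanation for c w.r.t. 𝒯 if and only if every leaf of the restriction 𝒯|τ is labeled c; (b) τ is a global contrastive explanation for c w.r.t. 𝒯 if and only if no leaf of 𝒯|τ is labeled c. -/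
namespace DT

variable {F : Type*}

/-- `T` has a leaf labeled `c`. -/
def HasLeaf : DT F → Bool → Prop
  | .leaf b, c => b = c
  | .node _ t0 t1, c => t0.HasLeaf c ∨ t1.HasLeaf c

end DT

namespace DT

variable {F : Type*}

theorem eval_congr {T : DT F} {e e' : F → Bool} (h : ∀ f ∈ T.feats, e f = e' f) :
    T.eval e = T.eval e' := by
  induction T with
  | leaf b => rfl
  | node f t0 t1 ih0 ih1 =>
    simp only [eval, h f (by simp [feats]), ih0 fun g hg => h g (by simp [feats, hg]),
      ih1 fun g hg => h g (by simp [feats, hg])]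

theorem eval_update_of_notMem_feats_s6 [DecidableEq F] {T : DT F} {f : F} (hf : f ∉ T.feats)
    (e : F → Bool) (b : Bool) : T.eval (Function.update e f b) = T.eval e :=
  eval_congr fun _ hg => Function.update_of_ne (ne_of_mem_of_not_mem hg hf) _ _

theorem allLeaves_iff_not_hasLeaf_not (T : DT F) (c : Bool) :
    T.AllLeaves c ↔ ¬ T.HasLeaf (!c) := by
  induction T with
  | leaf b => simp [AllLeaves, HasLeaf]
  | node f t0 t1 ih0 ih1 => simp [AllLeaves, HasLeaf, ih0, ih1]

theorem hasLeaf_eval (T : DT F) (e : F → Bool) : T.HasLeaf (T.eval e) := by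
  induction T with
  | leaf b => rfl
  | node f t0 t1 ih0 ih1 =>
    by_cases h : e f <;> simp [HasLeaf, eval, h, ih0, ih1]

variable [DecidableEq F]

theorem eval_restrict (T : DT F) {A : Finset F} {τ e : F → Bool} (he : ∀ f ∈ A, e f = τ f) :
    (T.restrict A τ).eval e = T.eval e := by
  induction T with
  | leaf b => rfl
  | node f t0 t1 ih0 ih1 =>
    by_cases hA : f ∈ A
    · cases h : τ f <;> simp [restrict, eval, hA, he f hA, h, ih0, ih1]
    · simp [restrict, eval, hA, ih0, ih1]

theorem exists_eval_eq_of_hasLeaf_restrict {T : DT F} (hT : T.ReadOnce) {A : Finset F}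
    {τ : F → Bool} {c : Bool} (h : (T.restrict A τ).HasLeaf c) :
    ∃ e : F → Bool, (∀ f ∈ A, e f = τ f) ∧ T.eval e = c := by
  induction T with
  | leaf b => exact ⟨τ, fun _ _ => rfl, h⟩
  | node f t0 t1 ih0 ih1 =>
    obtain ⟨hf0, hf1, hT0, hT1⟩ := hT
    by_cases hA : f ∈ A
    · cases hτ : τ f
      · obtain ⟨e, he, rfl⟩ := ih0 hT0 (by simpa [restrict, hA, hτ] using h)
        exact ⟨e, he, by simp [eval, he f hA, hτ]⟩
      · obtain ⟨e, he, rfl⟩ := ih1 hT1 (by simpa [restrict, hA, hτ] using h)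
        exact ⟨e, he, by simp [eval, he f hA, hτ]⟩
    · have agree {e : F → Bool} (he : ∀ g ∈ A, e g = τ g) (b : Bool) :
          ∀ g ∈ A, Function.update e f b g = τ g := fun g hg => by
        rw [Function.update_of_ne (ne_of_mem_of_not_mem hg hA), he g hg]
      simp only [restrict, hA, if_false, HasLeaf] at h
      rcases h with h | h
      · obtain ⟨e, he, rfl⟩ := ih0 hT0 h
        exact ⟨_, agree he false, by simp [eval, eval_update_of_notMem_feats_s6 hf0]⟩
      · obtain ⟨e, he, rfl⟩ := ih1 hT1 h
        exact ⟨_, agree he true, by simp [eval, eval_update_of_notMem_feats_s6 hf1]⟩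

theorem forall_eval_ne_iff_not_hasLeaf_restrict {T : DT F} (hT : T.ReadOnce) (A : Finset F)
    (τ : F → Bool) (c : Bool) :
    (∀ e : F → Bool, (∀ f ∈ A, e f = τ f) → T.eval e ≠ c) ↔ ¬ (T.restrict A τ).HasLeaf c := by
  refine ⟨fun h hc => ?_, fun h e he hc => h ?_⟩
  · obtain ⟨e, he, hec⟩ := exists_eval_eq_of_hasLeaf_restrict hT hc
    exact h e he hec
  · rw [← hc, ← eval_restrict T he]
    exact hasLeaf_eval _ e

end DT

/-- for a decision tree `T` in which no feature labels two inner
nodes on the same root-to-leaf path, a partial example `τ` with domain `A`, and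
a class `c`:
(a) `τ` is a global abductive explanation for `c` w.r.t. `T` iff every leaf of
`T|τ` is labeled `c`;
(b) `τ` is a global contrastive explanation for `c` w.r.t. `T` iff no leaf of
`T|τ` is labeled `c`. -/
theorem DT_global_explanations_iff_restrict {F : Type*} [DecidableEq F]
    (T : DT F) (hT : T.ReadOnce) (A : Finset F) (τ : F → Bool) (c : Bool) :
    ((∀ e : F → Bool, (∀ f ∈ A, e f = τ f) → T.eval e = c) ↔
        (T.restrict A τ).AllLeaves c) ∧
    ((∀ e : F → Bool, (∀ f ∈ A, e f = τ f) → T.eval e ≠ c) ↔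
        ¬ (T.restrict A τ).HasLeaf c) := by
  refine ⟨?_, DT.forall_eval_ne_iff_not_hasLeaf_restrict hT A τ c⟩
  rw [DT.allLeaves_iff_not_hasLeaf_not, ← DT.forall_eval_ne_iff_not_hasLeaf_restrict hT]
  simp
end

section
/- Let 𝒯₁, …, 𝒯_ℓ be decision trees over a finite feature set F. There exists a decision tree 𝒯 over F with at most ∏_{i=1}^{ℓ} |L(𝒯ᵢ)| leaves such that for every example e over F, 𝒯(e) = true if and only if at least ⌊ℓ/2⌋ + 1 of the trees 𝒯₁, …, 𝒯_ℓ satisfy 𝒯ᵢ(e) = true. -/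
namespace DT

/-- Replace every leaf labelled `b` by the tree `k b`. -/
def bind {F : Type*} : DT F → (Bool → DT F) → DT F
  | .leaf b, k => k b
  | .node f t0 t1, k => .node f (t0.bind k) (t1.bind k)

theorem eval_bind {F : Type*} (T : DT F) (k : Bool → DT F) (e : F → Bool) :
    (T.bind k).eval e = (k (T.eval e)).eval e := by
  induction T with
  | leaf b => rfl
  | node f t0 t1 ih0 ih1 =>
    simp only [bind, eval]
    split_ifs <;> assumption

theorem numLeaves_bind_le {F : Type*} (T : DT F) (k : Bool → DT F) (n : ℕ)
    (hk : ∀ b, (k b).numLeaves ≤ n) : (T.bind k).numLeaves ≤ T.numLeaves * n := by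
  induction T with
  | leaf b => simpa [bind, numLeaves] using hk b
  | node f t0 t1 ih0 ih1 =>
    simp only [bind, numLeaves, add_mul]
    exact add_le_add ih0 ih1

/-- Any Boolean function of the classifications of finitely many decision trees is computed by a
decision tree whose number of leaves is at most the product of theirs. -/
theorem exists_eval_eq_comp {F : Type*} (ℓ : ℕ) (Ts : Fin ℓ → DT F) (g : (Fin ℓ → Bool) → Bool) :
    ∃ T : DT F, T.numLeaves ≤ ∏ i, (Ts i).numLeaves ∧
      ∀ e : F → Bool, T.eval e = g fun i => (Ts i).eval e := by
  induction ℓ with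
  | zero =>
    refine ⟨.leaf (g Fin.elim0), by simp [numLeaves], fun e => ?_⟩
    exact congrArg g (Subsingleton.elim _ _)
  | succ ℓ ih =>
    choose k hk hke using fun b : Bool => ih (fun i => Ts i.succ) (fun v => g (Fin.cons b v))
    refine ⟨(Ts 0).bind k, ?_, fun e => ?_⟩
    · rw [Fin.prod_univ_succ]
      exact numLeaves_bind_le _ _ _ hk
    · rw [eval_bind, hke]
      congr 1
      ext i
      cases i using Fin.cases <;> rfl

end DT

/-- for decision trees `T₁, …, T_ℓ` over `F` there is a single
decision tree `T` with at most `∏ᵢ |L(Tᵢ)|` leaves computing the majority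
classification: `T e = true` iff at least `⌊ℓ/2⌋ + 1` of the trees classify `e`
as `true`. -/
theorem exists_majority_DT {F : Type*} (ℓ : ℕ) (Ts : Fin ℓ → DT F) :
    ∃ T : DT F, T.numLeaves ≤ ∏ i, (Ts i).numLeaves ∧
      ∀ e : F → Bool,
        (T.eval e = true ↔
          ℓ / 2 + 1 ≤ (Finset.univ.filter fun i => (Ts i).eval e = true).card) := by
  obtain ⟨T, hT, hTe⟩ := DT.exists_eval_eq_comp ℓ Ts fun v =>
    decide (ℓ / 2 + 1 ≤ (Finset.univ.filter fun i => v i = true).card)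
  exact ⟨T, hT, fun e => by rw [hTe, decide_eq_true_iff]⟩
end

section
/- Let L be a decision list over a finite feature set F, let e be an example over F classified by the rule r_i of L (so L(e) is the class of r_i), and let R be the set of rules of L whose class differs from L(e). Then: (1) for every rule r ∈ R and every set A ⊆ F such that the example e_A is classified by r, the set A is a local contrastive explanation for e w.r.t. L; and (2) every local contrastive explanation A for e w.r.t. L contains a subset A' ⊆ A such that e_{A'} is classified by some rule in R. -/
/-- A term over `F`: a finite set of literals `(f = z)`. -/
abbrev Term (F : Type*) := Finset (F × Bool)

/-- A term applies to (agrees with) an example `e` if `e f = z` for every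
literal `(f = z)` in it. -/
def Term.Applies {F : Type*} (t : Term F) (e : F → Bool) : Prop :=
  ∀ p ∈ t, e p.1 = p.2

instance {F : Type*} (t : Term F) (e : F → Bool) : Decidable (t.Applies e) :=
  inferInstanceAs (Decidable (∀ p ∈ t, e p.1 = p.2))

/-- A decision list is a list of rules (term, class); `DLeval` classifies an
example by the first rule whose term applies to it. -/
def DLeval {F : Type*} : List (Term F × Bool) → (F → Bool) → Bool
  | [], _ => false
  | r :: rs, e => if r.1.Applies e then r.2 else DLeval rs e

/-- `ClassifiedBy L e i` : the `i`-th rule of `L` is the first rule that applies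
to the example `e` (so it is the rule classifying `e`). -/
def ClassifiedBy {F : Type*} (L : List (Term F × Bool)) (e : F → Bool) (i : ℕ) : Prop :=
  ∃ h : i < L.length, (L.get ⟨i, h⟩).1.Applies e ∧
    ∀ j (hj : j < i), ¬ (L.get ⟨j, hj.trans h⟩).1.Applies e

/-- A decision list evaluates to the class of the first rule that applies. -/
theorem ClassifiedBy.eval_eq {F : Type*} {L : List (Term F × Bool)} {e : F → Bool} {i : ℕ}
    (h : ClassifiedBy L e i) : DLeval L e = (L.get ⟨i, h.1⟩).2 := by
  obtain ⟨hi, happ, hfirst⟩ := h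
  induction L generalizing i with
  | nil => exact absurd hi (Nat.not_lt_zero i)
  | cons r rs ih =>
    cases i with
    | zero => exact if_pos happ
    | succ i =>
      have hr : ¬ r.1.Applies e := hfirst 0 i.succ_pos
      refine (if_neg hr).trans (ih (Nat.lt_of_succ_lt_succ hi) happ fun j hj => ?_)
      exact hfirst (j + 1) (Nat.succ_lt_succ hj)

/-- If some rule of a list applies to `e`, then some rule is the first to do so. -/
theorem exists_classifiedBy {F : Type*} {L : List (Term F × Bool)} {e : F → Bool}
    (h : ∃ r ∈ L, r.1.Applies e) : ∃ i, ClassifiedBy L e i := by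
  classical
  obtain ⟨r, hr, happ⟩ := h
  obtain ⟨k, rfl⟩ := List.get_of_mem hr
  have hex : ∃ n, ∃ h : n < L.length, (L.get ⟨n, h⟩).1.Applies e := ⟨k, k.2, happ⟩
  obtain ⟨hlt, hfind⟩ := Nat.find_spec hex
  exact ⟨Nat.find hex, hlt, hfind, fun j hj hj' => Nat.find_min hex hj ⟨hj.trans hlt, hj'⟩⟩

/-- Flipping `e` on the features where it differs from `e'` yields `e'`. -/
theorem flipOn_filter_ne {F : Type*} [Fintype F] [DecidableEq F] (e e' : F → Bool) :
    flipOn e (Finset.univ.filter fun f => e' f ≠ e f) = e' := by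
  funext f
  by_cases h : e' f = e f
  · simp [flipOn, h]
  · simpa [flipOn, h] using (Bool.eq_not.mpr h).symm

/-- let `L` be a decision list (nonempty, last rule with empty
term), `e` an example classified by the rule `r_i` of `L`, and let `R` be the
set of rules of `L` whose class differs from `L e`. Then:
(1) for every rule `r_j ∈ R` and every set `A` such that `e_A` is classified by
`r_j`, the set `A` is a local contrastive explanation for `e` w.r.t. `L`;
(2) every local contrastive explanation `A` for `e` w.r.t. `L` contains a subset
`A' ⊆ A` such that `e_{A'}` is classified by some rule of `R`. -/
theorem DL_lCXp_characterization {F : Type*} [Fintype F] [DecidableEq F]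
    (L : List (Term F × Bool)) (hL : L ≠ []) (hlast : (L.getLast hL).1 = ∅)
    (e : F → Bool) (i : ℕ) (hi : ClassifiedBy L e i) :
    (∀ (j : ℕ) (hj : j < L.length) (A : Finset F),
        (L.get ⟨j, hj⟩).2 ≠ DLeval L e → ClassifiedBy L (flipOn e A) j →
        ∃ e' : F → Bool, DLeval L e' ≠ DLeval L e ∧ ∀ f : F, e' f ≠ e f → f ∈ A) ∧
    (∀ A : Finset F,
        (∃ e' : F → Bool, DLeval L e' ≠ DLeval L e ∧ ∀ f : F, e' f ≠ e f → f ∈ A) →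
        ∃ A' ⊆ A, ∃ (j : ℕ) (hj : j < L.length),
          (L.get ⟨j, hj⟩).2 ≠ DLeval L e ∧ ClassifiedBy L (flipOn e A') j) := by
  refine ⟨fun j hj A hne hA => ⟨flipOn e A, hA.eval_eq ▸ hne, fun f hf => ?_⟩, ?_⟩
  · by_contra hfA
    exact hf (if_neg hfA)
  · rintro A ⟨e', hne, hdiff⟩
    obtain ⟨j, hj⟩ := exists_classifiedBy (L := L) (e := e')
      ⟨L.getLast hL, L.getLast_mem hL, by simp [hlast, Term.Applies]⟩
    refine ⟨Finset.univ.filter fun f => e' f ≠ e f, fun f hf => hdiff f (by simpa using hf),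
      j, hj.1, hj.eval_eq ▸ hne, ?_⟩
    rwa [flipOn_filter_ne]
end

section
/- Let G be a finite simple graph with n vertices and m edges and let k ≥ 1. For an example e : V(G) → Bool define N(e) = |{ {u,v} : u ≠ v, uv ∉ E(G), and e(u) = false or e(v) = false }| + |{ v ∈ V(G) : e(v) = true }|. Then G has a clique of size k if and only if there exists an example e : V(G) → Bool with |{v : e(v) = true}| ≤ k and N(e) ≥ (C(n,2) − m) + k. (Equivalently, e is classified positively by a majority of the 2(C(n,2)−m)+2k−1 ensemble elements constructed in the reduction, whereas the all-zero example, with N(e₀) = C(n,2) − m, is classified negatively.) -/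
/-- The non-edges of `G` number `C(n,2) - m`. -/
theorem SimpleGraph.card_nonedges {V : Type*} [Fintype V] [DecidableEq V]
    (G : SimpleGraph V) [DecidableRel G.Adj] :
    (Finset.univ.filter fun p : Sym2 V => ¬ p.IsDiag ∧ p ∉ G.edgeFinset).card =
      (Fintype.card V).choose 2 - G.edgeFinset.card := by
  have hsub : G.edgeFinset ⊆ Finset.univ.filter fun p : Sym2 V => ¬ p.IsDiag := fun p hp =>
    Finset.mem_filter.2 ⟨Finset.mem_univ p,
      G.not_isDiag_of_mem_edgeSet (SimpleGraph.mem_edgeFinset.1 hp)⟩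
  rw [← Sym2.card_subtype_not_diag, Fintype.card_subtype, ← Finset.card_sdiff_of_subset hsub]
  congr 1
  ext p
  simp only [Finset.mem_filter, Finset.mem_univ, true_and, Finset.mem_sdiff]

/-- let `G` be a finite simple graph with `n` vertices and `m`
edges and let `k ≥ 1`.  For an example `e : V(G) → Bool` put
`N e = #{ {u,v} : u ≠ v, uv ∉ E(G), e u = false or e v = false } + #{ v : e v = true }`.
Then `G` has a clique of size `k` iff there is an example `e` with at most `k`
features set to `true` and `N e ≥ (C(n,2) − m) + k`. -/
theorem clique_iff_majority_example {V : Type*} [Fintype V] [DecidableEq V]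
    (G : SimpleGraph V) [DecidableRel G.Adj] (k : ℕ) (hk : 1 ≤ k) :
    (∃ s : Finset V, s.card = k ∧ ∀ u ∈ s, ∀ v ∈ s, u ≠ v → G.Adj u v) ↔
    (∃ e : V → Bool,
        (Finset.univ.filter fun v => e v = true).card ≤ k ∧
        (Fintype.card V).choose 2 - G.edgeFinset.card + k ≤
          (Finset.univ.filter fun p : Sym2 V =>
              ¬ p.IsDiag ∧ p ∉ G.edgeFinset ∧ ¬ ∀ u ∈ p, e u = true).card +
          (Finset.univ.filter fun v => e v = true).card) := by
  rw [← G.card_nonedges]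
  constructor
  · rintro ⟨s, hs, hclique⟩
    have hcard : (Finset.univ.filter fun v => decide (v ∈ s) = true).card = k := by
      simpa using hs
    refine ⟨fun v => decide (v ∈ s), hcard.le, ?_⟩
    rw [hcard]
    refine Nat.add_le_add_right (Finset.card_le_card fun p hp => ?_) k
    simp only [Finset.mem_filter, Finset.mem_univ, true_and] at hp ⊢
    refine ⟨hp.1, hp.2, fun hall => hp.2 ?_⟩
    induction p with
    | h u v =>
      simp only [decide_eq_true_eq] at hall
      rw [SimpleGraph.mem_edgeFinset, SimpleGraph.mem_edgeSet]
      exact hclique u (hall u (Sym2.mem_mk_left u v)) v (hall v (Sym2.mem_mk_right u v))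
        fun h => hp.1 (Sym2.mk_isDiag_iff.2 h)
  · rintro ⟨e, he, hN⟩
    have hsub : (Finset.univ.filter fun p : Sym2 V =>
          ¬ p.IsDiag ∧ p ∉ G.edgeFinset ∧ ¬ ∀ u ∈ p, e u = true) ⊆
        Finset.univ.filter fun p : Sym2 V => ¬ p.IsDiag ∧ p ∉ G.edgeFinset := fun p hp => by
      simp only [Finset.mem_filter, Finset.mem_univ, true_and] at hp ⊢
      exact ⟨hp.1, hp.2.1⟩
    have hle := Finset.card_le_card hsub
    refine ⟨Finset.univ.filter fun v => e v = true, by omega, fun u hu v hv huv => ?_⟩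
    have heq := Finset.eq_of_subset_of_card_le hsub (by omega)
    simp only [Finset.mem_filter, Finset.mem_univ, true_and] at hu hv
    by_contra hadj
    have hmem : s(u, v) ∈ Finset.univ.filter fun p : Sym2 V =>
        ¬ p.IsDiag ∧ p ∉ G.edgeFinset := by
      simp [huv, hadj]
    rw [← heq] at hmem
    refine (Finset.mem_filter.1 hmem).2.2.2 fun w hw => ?_
    rcases Sym2.mem_iff.1 hw with rfl | rfl
    · exact hu
    · exact hv
end

section
/- Let U be a finite set, let 𝓕 be a finite family of nonempty subsets of U, and let k ∈ ℕ. Define the model M over the feature set U by M(e) = true if and only if there is a set S ∈ 𝓕 such that e is the indicator function of S (i.e., e(u) = true exactly when u ∈ S). Then 𝓕 has a hitting set of size at most k if and only if there is a local abductive explanation A for the all-zero example e₀ w.r.t. M with |A| ≤ k. -/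
/-- let `U` be a finite set, `𝓕` a finite family of nonempty
subsets of `U`, `k ∈ ℕ`, and let `M` be the model over `U` with `M e = true` iff
`e` is the indicator function of some `S ∈ 𝓕`.  Then `𝓕` has a hitting set of
size at most `k` iff there is a local abductive explanation `A` for the
all-zero example `e₀` w.r.t. `M` with `|A| ≤ k`. -/
theorem hittingSet_iff_small_lAXp {U : Type*} [Fintype U] [DecidableEq U]
    (𝓕 : Finset (Finset U)) (hne : ∀ S ∈ 𝓕, S.Nonempty) (k : ℕ)
    (M : (U → Bool) → Bool)
    (hM : ∀ e : U → Bool, M e = true ↔ ∃ S ∈ 𝓕, ∀ u : U, e u = true ↔ u ∈ S) :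
    (∃ H : Finset U, H.card ≤ k ∧ ∀ T ∈ 𝓕, ∃ u ∈ H, u ∈ T) ↔
    (∃ A : Finset U, A.card ≤ k ∧
        ∀ e' : U → Bool, (∀ u ∈ A, e' u = false) → M e' = M (fun _ => false)) := by
  have h_zero : M (fun _ => false) = false := by
    rw [Bool.eq_false_iff, Ne, hM]
    rintro ⟨S, hS, h⟩
    obtain ⟨u, hu⟩ := hne S hS
    exact Bool.false_ne_true ((h u).2 hu)
  refine exists_congr fun A => and_congr_right fun _ => ?_
  rw [h_zero]
  constructor
  · intro hA e he
    rw [Bool.eq_false_iff, Ne, hM]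
    rintro ⟨S, hS, h⟩
    obtain ⟨u, huA, huS⟩ := hA S hS
    exact Bool.false_ne_true ((he u huA).symm.trans ((h u).2 huS))
  · intro hA T hT
    by_contra! h_disj
    have h_true : M (fun u => decide (u ∈ T)) = true :=
      (hM _).2 ⟨T, hT, fun u => decide_eq_true_iff⟩
    rw [hA _ fun u hu => decide_eq_false (h_disj u hu)] at h_true
    exact Bool.false_ne_true h_true
end

section
/- Let G be a finite simple graph with a proper k-coloring with color classes V₁, …, V_k, where k ≥ 1. Define the model M over the feature set V(G) by M(e) = true if and only if both: for all distinct non-adjacent vertices u, v of G, e(u) = false or e(v) = false; and for every i ∈ {1,…,k} there is some v ∈ V_i with e(v) = true. Then G has a multicolored k-clique if and only if there is a local contrastive explanation A for the all-zero example e₀ w.r.t. M with |A| ≤ k. -/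
/-- let `G` be a graph with a proper `k`-coloring `C` (`k ≥ 1`) and
let `M` be the model over `V(G)` with `M e = true` iff (i) for all distinct
non-adjacent `u, v` at least one of `e u`, `e v` is `false`, and (ii) every color
class contains a vertex set to `true`.  Then `G` has a multicolored `k`-clique
iff there is a local contrastive explanation `A` for the all-zero example `e₀`
w.r.t. `M` with `|A| ≤ k`. -/
theorem multicoloredClique_iff_small_lCXp {V : Type*} [Fintype V] [DecidableEq V]
    (G : SimpleGraph V) (k : ℕ) (hk : 1 ≤ k) (C : V → Fin k)
    (hC : ∀ u v, G.Adj u v → C u ≠ C v)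
    (M : (V → Bool) → Bool)
    (hM : ∀ e : V → Bool, M e = true ↔
        ((∀ u v : V, u ≠ v → ¬ G.Adj u v → (e u = false ∨ e v = false)) ∧
          ∀ i : Fin k, ∃ v : V, C v = i ∧ e v = true)) :
    (∃ g : Fin k → V, (∀ i, C (g i) = i) ∧ ∀ i j, i ≠ j → G.Adj (g i) (g j)) ↔
    (∃ A : Finset V, A.card ≤ k ∧
        ∃ e' : V → Bool, M e' ≠ M (fun _ => false) ∧ ∀ v : V, e' v ≠ false → v ∈ A) := by
  have h_zero : M (fun _ => false) = false := by
    rw [← Bool.not_eq_true, hM]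
    rintro ⟨-, h⟩
    obtain ⟨v, -, hv⟩ := h ⟨0, hk⟩
    exact Bool.false_ne_true hv
  constructor
  · rintro ⟨g, hg, hadj⟩
    refine ⟨Finset.univ.image g, Finset.card_image_le.trans (by simp),
      fun v => decide (v ∈ Finset.univ.image g), ?_, fun v hv => by simpa using hv⟩
    rw [h_zero, Bool.ne_false_iff, hM]
    refine ⟨fun u v huv hnadj => ?_, fun i => ⟨g i, hg i, by simp⟩⟩
    by_contra! h
    obtain ⟨hu, hv⟩ := h
    obtain ⟨i, rfl⟩ : ∃ i, g i = u := by simpa using hu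
    obtain ⟨j, rfl⟩ : ∃ j, g j = v := by simpa using hv
    exact hnadj (hadj i j fun hij => huv (congrArg g hij))
  · rintro ⟨-, -, e', he', -⟩
    rw [h_zero, Bool.ne_false_iff, hM] at he'
    obtain ⟨hclique, hcover⟩ := he'
    choose g hg hge using hcover
    refine ⟨g, hg, fun i j hij => ?_⟩
    by_contra hnadj
    have hne : g i ≠ g j := fun h => hij (by rw [← hg i, ← hg j, h])
    rcases hclique _ _ hne hnadj with h | h <;> simp [hge] at h
end

section
/- Let G be a finite simple graph with a proper k-coloring with color classes V₁, …, V_k. For an example e : V(G) → Bool define P(e) = |{ i ∈ {1,…,k} : exactly one vertex v ∈ V_i has e(v) = true }| + |{ (i,j) : 1 ≤ i < j ≤ k, and there is an edge uv ∈ E(G) with u ∈ V_i and v ∈ V_j such that u and v are the only vertices of V_i ∪ V_j with e-value true }|. Then the following are equivalent: (a) G has a multicolored k-clique; (b) there exists an example e with P(e) ≥ k + C(k,2); (c) there exists an example e with |{v : e(v) = true}| ≤ k and P(e) ≥ k + C(k,2). -/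
theorem card_filter_fst_lt_snd (k : ℕ) :
    (Finset.univ.filter fun q : Fin k × Fin k => q.1 < q.2).card = k.choose 2 := by
  rw [Finset.card_filter, Fintype.sum_prod_type_right]
  have h (j : Fin k) : (∑ i : Fin k, if i < j then 1 else 0) = (j : ℕ) := by
    rw [← Finset.card_filter, Finset.filter_gt_eq_Iio, Fin.card_Iio]
  simp only [h]
  rw [Fin.sum_univ_eq_sum_range (fun i => i), Finset.sum_range_id, Nat.choose_two_right]


/-- let `G` be a graph with a proper `k`-coloring with classes
`V₁, …, V_k`.  For an example `e` let
`P e = #{ i : exactly one v ∈ V_i has e v = true }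
     + #{ (i,j) : i < j and there is an edge uv with u ∈ V_i, v ∈ V_j such that
          u and v are the only true vertices of V_i ∪ V_j }`.
Then the following are equivalent: (a) `G` has a multicolored `k`-clique;
(b) some example `e` has `P e ≥ k + C(k,2)`; (c) some example `e` with at most
`k` features set to `true` has `P e ≥ k + C(k,2)`. -/
theorem multicoloredClique_tfae_majority {V : Type*} [Fintype V] [DecidableEq V]
    (G : SimpleGraph V) [DecidableRel G.Adj] (k : ℕ) (C : V → Fin k)
    (hC : ∀ u v, G.Adj u v → C u ≠ C v) :
    (let P : (V → Bool) → ℕ := fun e =>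
      (Finset.univ.filter fun i : Fin k =>
          (Finset.univ.filter fun v => C v = i ∧ e v = true).card = 1).card +
      (Finset.univ.filter fun q : Fin k × Fin k => q.1 < q.2 ∧
          ∃ u v : V, G.Adj u v ∧ C u = q.1 ∧ C v = q.2 ∧ e u = true ∧ e v = true ∧
            ∀ w : V, (C w = q.1 ∨ C w = q.2) → e w = true → (w = u ∨ w = v)).card
    [ (∃ g : Fin k → V, (∀ i, C (g i) = i) ∧ ∀ i j, i ≠ j → G.Adj (g i) (g j)),
      (∃ e : V → Bool, k + k.choose 2 ≤ P e),
      (∃ e : V → Bool,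
          (Finset.univ.filter fun v => e v = true).card ≤ k ∧ k + k.choose 2 ≤ P e)
    ].TFAE) := by
  intro P
  tfae_have 1 → 3 := by
    rintro ⟨g, hg, hadj⟩
    have htrue (v : V) : decide (v = g (C v)) = true ↔ v = g (C v) := decide_eq_true_iff
    have hgC (i : Fin k) : g i = g (C (g i)) := by rw [hg]
    refine ⟨fun v => decide (v = g (C v)), ?_, ?_⟩
    · calc
        _ ≤ (Finset.univ.image g).card := by
          refine Finset.card_le_card fun v hv => ?_
          rw [Finset.mem_filter_univ, htrue] at hv
          exact Finset.mem_image.2 ⟨C v, Finset.mem_univ _, hv.symm⟩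
        _ ≤ k := by simpa using Finset.card_image_le (s := Finset.univ) (f := g)
    · refine Nat.add_le_add ?_ ?_
      · rw [Finset.filter_true_of_mem, Finset.card_univ, Fintype.card_fin]
        intro i _
        refine Finset.card_eq_one.2 ⟨g i, Finset.ext fun v => ?_⟩
        rw [Finset.mem_filter_univ, htrue, Finset.mem_singleton]
        exact ⟨fun ⟨hi, hv⟩ => hi ▸ hv, fun hv => hv ▸ ⟨hg i, hgC i⟩⟩
      · rw [← card_filter_fst_lt_snd]
        refine Finset.card_le_card fun q hq => ?_
        rw [Finset.mem_filter_univ] at hq ⊢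
        refine ⟨hq, g q.1, g q.2, hadj _ _ hq.ne, hg _, hg _, (htrue _).2 (hgC _),
          (htrue _).2 (hgC _), fun w hw he => ?_⟩
        rw [htrue] at he
        exact hw.imp (fun h : C w = q.1 => h ▸ he) fun h : C w = q.2 => h ▸ he
  tfae_have 3 → 2 := fun ⟨e, _, he⟩ => ⟨e, he⟩
  tfae_have 2 → 1 := by
    rintro ⟨e, he⟩
    obtain ⟨A, hA⟩ : ∃ A, A = Finset.univ.filter fun i : Fin k =>
        (Finset.univ.filter fun v => C v = i ∧ e v = true).card = 1 := ⟨_, rfl⟩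
    obtain ⟨B, hB⟩ : ∃ B, B = Finset.univ.filter fun q : Fin k × Fin k => q.1 < q.2 ∧
        ∃ u v : V, G.Adj u v ∧ C u = q.1 ∧ C v = q.2 ∧ e u = true ∧ e v = true ∧
          ∀ w : V, (C w = q.1 ∨ C w = q.2) → e w = true → (w = u ∨ w = v) := ⟨_, rfl⟩
    have hAB : k + k.choose 2 ≤ A.card + B.card := by rw [hA, hB]; exact he
    have hAk : A.card ≤ k := by simpa using A.card_le_univ
    have hBsub : B ⊆ Finset.univ.filter fun q : Fin k × Fin k => q.1 < q.2 := by
      rw [hB]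
      exact Finset.monotone_filter_right _ fun _ _ h => h.1
    have hBk : B.card ≤ k.choose 2 :=
      (Finset.card_le_card hBsub).trans_eq (card_filter_fst_lt_snd k)
    have hAuniv : A = Finset.univ :=
      Finset.eq_univ_of_card A (by rw [Fintype.card_fin]; omega)
    have hBeq := Finset.eq_of_subset_of_card_le hBsub (by rw [card_filter_fst_lt_snd]; omega)
    have hunique (i : Fin k) : ∃ v, ∀ w, C w = i ∧ e w = true ↔ w = v := by
      have hi : i ∈ A := hAuniv ▸ Finset.mem_univ i
      rw [hA, Finset.mem_filter_univ, Finset.card_eq_one] at hi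
      obtain ⟨v, hv⟩ := hi
      exact ⟨v, fun w => by simpa using Finset.ext_iff.1 hv w⟩
    choose g hg using hunique
    have hlt (i j : Fin k) (hij : i < j) : G.Adj (g i) (g j) := by
      have hq : (i, j) ∈ B := hBeq ▸ (Finset.mem_filter_univ _).2 hij
      rw [hB, Finset.mem_filter_univ] at hq
      obtain ⟨-, u, v, huv, hu, hv, heu, hev, -⟩ := hq
      rwa [← (hg i u).1 ⟨hu, heu⟩, ← (hg j v).1 ⟨hv, hev⟩]
    exact ⟨g, fun i => ((hg i (g i)).2 rfl).1, fun i j hij =>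
      hij.lt_or_gt.elim (hlt i j) fun h => (hlt j i h).symm⟩
  tfae_finish
end

section
/- Let F be a finite set of features, M a model over F, e an example over F, and k ∈ ℕ with k ≤ |F|. Define the model M' over F by M'(e') = M(e) if M(e') = M(e) and |{ f ∈ F : e'(f) = e(f) }| ≥ k, and M'(e') = ¬M(e) otherwise. Then the following are equivalent: (1) there exists a local abductive explanation A for e w.r.t. M with |A| ≤ k; (2) there exists a global abductive explanation of size at most k for the class M(e) w.r.t. M'; (3) there exists a global contrastive explanation of size at most k for the class ¬M(e) w.r.t. M'. -/
/-- A conditional choosing between `b` and its negation equals `b` iff the condition holds. -/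
theorem Bool.ite_self_not_eq_self_iff {p : Prop} [Decidable p] (b : Bool) :
    (if p then b else !b) = b ↔ p := by
  by_cases hp : p <;> simp [hp]

/-- If every example agreeing with `τ` on `A` agrees with `e` on at least `A.card` features,
then `τ` agrees with `e` on `A`. -/
theorem eqOn_of_card_le_card_agree {F : Type*} [Fintype F] [DecidableEq F]
    (e τ : F → Bool) (A : Finset F)
    (h : ∀ e' : F → Bool, (∀ f ∈ A, e' f = τ f) →
      A.card ≤ (Finset.univ.filter fun f => e' f = e f).card) :
    ∀ f ∈ A, τ f = e f := by
  have hsub : (Finset.univ.filter fun f => (if f ∈ A then τ f else !(e f)) = e f) ⊆ A := by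
    intro f hf
    by_contra hfA
    simp [hfA] at hf
  have heq := Finset.eq_of_subset_of_card_le hsub
    (h (fun f => if f ∈ A then τ f else !(e f)) fun f hf => by simp [hf])
  intro f hf
  rw [← heq] at hf
  simpa [hsub hf] using (Finset.mem_filter.mp hf).2

/-- let `M` be a model over a finite feature set `F`, `e` an
example, and `k ≤ |F|`.  Let `M'` be the model with `M' e' = M e` if
`M e' = M e` and `e'` agrees with `e` on at least `k` features, and
`M' e' = ¬(M e)` otherwise.  Then the following are equivalent:
(1) there is a local abductive explanation for `e` w.r.t. `M` of size `≤ k`;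
(2) there is a global abductive explanation of size `≤ k` for the class `M e`
w.r.t. `M'`;
(3) there is a global contrastive explanation of size `≤ k` for the class
`¬(M e)` w.r.t. `M'`. -/
theorem lAXp_iff_gAXp_iff_gCXp {F : Type*} [Fintype F] [DecidableEq F]
    (M M' : (F → Bool) → Bool) (e : F → Bool) (k : ℕ) (hk : k ≤ Fintype.card F)
    (hM' : ∀ e' : F → Bool,
      M' e' = if M e' = M e ∧ k ≤ (Finset.univ.filter fun f => e' f = e f).card
        then M e else !(M e)) :
    [ (∃ A : Finset F, A.card ≤ k ∧
          ∀ e' : F → Bool, (∀ f ∈ A, e' f = e f) → M e' = M e),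
      (∃ (A : Finset F) (τ : F → Bool), A.card ≤ k ∧
          ∀ e' : F → Bool, (∀ f ∈ A, e' f = τ f) → M' e' = M e),
      (∃ (A : Finset F) (τ : F → Bool), A.card ≤ k ∧
          ∀ e' : F → Bool, (∀ f ∈ A, e' f = τ f) → M' e' ≠ !(M e))
    ].TFAE := by
  have hM'_iff (e' : F → Bool) : M' e' = M e ↔
      M e' = M e ∧ k ≤ (Finset.univ.filter fun f => e' f = e f).card := by
    rw [hM', Bool.ite_self_not_eq_self_iff]
  tfae_have 1 → 2 := by
    rintro ⟨A, hA, h⟩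
    obtain ⟨B, hAB, hB⟩ := Finset.exists_superset_card_eq hA hk
    refine ⟨B, e, hB.le, fun e' he' => (hM'_iff e').2 ⟨h e' fun f hf => he' f (hAB hf), ?_⟩⟩
    rw [← hB]
    exact Finset.card_le_card fun f hf => by simpa using he' f hf
  tfae_have 2 → 1 := by
    rintro ⟨A, τ, hA, h⟩
    have hτ := eqOn_of_card_le_card_agree e τ A fun e' he' =>
      hA.trans ((hM'_iff e').1 (h e' he')).2
    exact ⟨A, hA, fun e' he' =>
      ((hM'_iff e').1 (h e' fun f hf => (he' f hf).trans (hτ f hf).symm)).1⟩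
  tfae_have 2 ↔ 3 := by
    simp only [ne_eq, Bool.not_eq_not]
  tfae_finish
end

section
/- Let G be a finite simple graph with vertices v₁, …, v_n and a proper k-coloring with color classes V₁, …, V_k. Consider the feature set consisting of, for every vertex v_a, the k+2 features f_a, f_a', f_a^1, …, f_a^k, and, for every edge v_a v_b of G with a < b, the three features f'_{a,b}, f_{a,b}, f_{b,a}. Then G has a multicolored k-clique if and only if there exists an assignment e of Boolean values to all these features satisfying all of the following: (1) for every vertex v_a, the features f_a, f_a', f_a^1, …, f_a^k all receive the same value; (2) for every edge v_a v_b with a < b, the features f'_{a,b}, f_{a,b}, f_{b,a} all receive the same value; (3) for every i ∈ {1,…,k}, exactly one feature in { f_a' : v_a ∈ V_i } receives value true; (4) for every pair 1 ≤ i < j ≤ k, exactly one feature in { f'_{min(a,b),max(a,b)} : v_a ∈ V_i, v_b ∈ V_j, v_a v_b ∈ E(G) } receives value true; (5) for every pair i ≠ j with i, j ∈ {1,…,k} and every v_a ∈ V_i, e(f_a^j) = true if and only if at least one feature in { f_{a,b} : v_b ∈ V_j, v_a v_b ∈ E(G) } receives value true. -/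
/-- let `G` be a graph on a linearly ordered vertex set with a
proper `k`-coloring `C`.  Features: for every vertex `a` the `k+2` features
`f_a` (value `x a`), `f_a'` (value `x' a`), `f_a^j` (value `xj a j`); for every
edge `ab` with `a < b` the three features `f'_{a,b}` (value `y' a b`),
`f_{a,b}` (value `y a b`) and `f_{b,a}` (value `y b a`).
Then `G` has a multicolored `k`-clique iff there is an assignment of Boolean
values to all these features satisfying:
(1) for every vertex `a`, the features `f_a, f_a', f_a^1, …, f_a^k` all get the
    same value;
(2) for every edge `ab` with `a < b`, the features `f'_{a,b}, f_{a,b}, f_{b,a}`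
    all get the same value;
(3) for every color `i`, exactly one feature in `{ f_a' : C a = i }` is `true`;
(4) for every pair `i < j`, exactly one feature in
    `{ f'_{min(a,b),max(a,b)} : C a = i, C b = j, ab ∈ E(G) }` is `true`;
(5) for all `i ≠ j` and every `a` with `C a = i`, `f_a^j` is `true` iff some
    feature in `{ f_{a,b} : C b = j, ab ∈ E(G) }` is `true`. -/
theorem multicoloredClique_iff_OBDD_assignment {V : Type*} [Fintype V]
    [LinearOrder V] (G : SimpleGraph V) (k : ℕ) (C : V → Fin k)
    (hC : ∀ u v, G.Adj u v → C u ≠ C v) :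
    (∃ g : Fin k → V, (∀ i, C (g i) = i) ∧ ∀ i j, i ≠ j → G.Adj (g i) (g j)) ↔
    (∃ (x x' : V → Bool) (xj : V → Fin k → Bool) (y' y : V → V → Bool),
      -- (1) all features of a vertex receive the same value
      (∀ a : V, x' a = x a ∧ ∀ j : Fin k, xj a j = x a) ∧
      -- (2) all features of an edge receive the same value
      (∀ a b : V, G.Adj a b → a < b → (y' a b = y a b ∧ y b a = y a b)) ∧
      -- (3) exactly one vertex feature `f_a'` per color class is true
      (∀ i : Fin k, ∃! a : V, C a = i ∧ x' a = true) ∧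
      -- (4) exactly one edge feature `f'_{min,max}` per color pair is true
      (∀ i j : Fin k, i < j →
        ∃! p : V × V, p.1 < p.2 ∧ G.Adj p.1 p.2 ∧
          ((C p.1 = i ∧ C p.2 = j) ∨ (C p.1 = j ∧ C p.2 = i)) ∧
          y' p.1 p.2 = true) ∧
      -- (5) `f_a^j` is true iff some incident edge feature towards class `j` is
      (∀ i j : Fin k, i ≠ j → ∀ a : V, C a = i →
        (xj a j = true ↔ ∃ b : V, C b = j ∧ G.Adj a b ∧ y a b = true))) := by
  constructor
  · rintro ⟨g, hg, hadj⟩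
    have eq_of_color : ∀ {a : V} {i : Fin k}, C a = i → g (C a) = a → a = g i := by
      rintro a i rfl h
      exact h.symm
    refine ⟨fun a => decide (g (C a) = a), fun a => decide (g (C a) = a),
      fun a _ => decide (g (C a) = a),
      fun a b => decide (g (C a) = a ∧ g (C b) = b),
      fun a b => decide (g (C a) = a ∧ g (C b) = b), ?_, ?_, ?_, ?_, ?_⟩
    · exact fun a => ⟨rfl, fun _ => rfl⟩
    · exact fun a b _ _ => ⟨rfl, by simp only [and_comm]⟩
    · refine fun i => ⟨g i, by simp [hg], ?_⟩
      rintro a ⟨ha, hx⟩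
      exact eq_of_color ha (by simpa using hx)
    · intro i j hij
      have h := hadj i j hij.ne
      rcases lt_or_gt_of_ne h.ne with hlt | hlt
      · refine ⟨(g i, g j), by simp [hg, hlt, h], ?_⟩
        rintro ⟨a, b⟩ ⟨hab, -, hc, hy⟩
        simp only [decide_eq_true_eq] at hab hc hy
        rcases hc with ⟨ha, hb⟩ | ⟨ha, hb⟩
        · rw [eq_of_color ha hy.1, eq_of_color hb hy.2]
        · rw [eq_of_color ha hy.1, eq_of_color hb hy.2] at hab
          exact absurd hab hlt.asymm
      · refine ⟨(g j, g i), by simp [hg, hlt, h.symm], ?_⟩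
        rintro ⟨a, b⟩ ⟨hab, -, hc, hy⟩
        simp only [decide_eq_true_eq] at hab hc hy
        rcases hc with ⟨ha, hb⟩ | ⟨ha, hb⟩
        · rw [eq_of_color ha hy.1, eq_of_color hb hy.2] at hab
          exact absurd hab hlt.asymm
        · rw [eq_of_color ha hy.1, eq_of_color hb hy.2]
    · intro i j hij a ha
      simp only [decide_eq_true_eq]
      constructor
      · intro h
        refine ⟨g j, hg j, ?_, h, by rw [hg]⟩
        rw [eq_of_color ha h]
        exact hadj i j hij
      · rintro ⟨b, -, -, h, -⟩
        exact h
  · rintro ⟨x, x', xj, y', y, h1, h2, h3, -, h5⟩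
    choose g hg huniq using h3
    refine ⟨g, fun i => (hg i).1, fun i j hij => ?_⟩
    have hxj : xj (g i) j = true := by
      rw [(h1 _).2, ← (h1 _).1]
      exact (hg i).2
    obtain ⟨b, hb, hadj, hy⟩ := (h5 i j hij (g i) (hg i).1).1 hxj
    have hy_symm : y b (g i) = true := by
      rcases lt_or_gt_of_ne hadj.ne with hlt | hlt
      · rw [(h2 _ _ hadj hlt).2, hy]
      · rw [← (h2 _ _ hadj.symm hlt).2, hy]
    have hxb : xj b i = true :=
      (h5 j i hij.symm b hb).2 ⟨g i, (hg i).1, hadj.symm, hy_symm⟩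
    rw [(h1 b).2, ← (h1 b).1] at hxb
    rwa [← huniq j b ⟨hb, hxb⟩]
end
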